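/- Let k ≥ 1, k+1 ≤ l ≤ s−2 and s ≤ n. The number of k-flaw preference sets α of length n (with n spaces), entries at most s and first entry l satisfying τ_α = l − h_α, n_α = 1 and h_α = k−1 equals C(n−1, l−k) · p_{l−k, l−1; ≤ l−1} · p^{s−l}_{n+k−l; ≤ s−l; 1}, where C(a,b) is the binomial coefficient. -/

import Mathlib

/-- One parking step: a car with preference `a` parks in the first unoccupied
space `j` with `a ≤ j ≤ m`, if such a space exists; otherwise it leaves. -/
def parkStep (m : ℕ) (occ : Finset ℕ) (a : ℕ) : Finset ℕ :=
  if h : ((Finset.Icc a m) \ occ).Nonempty then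
    insert (((Finset.Icc a m) \ occ).min' h) occ
  else occ

/-- The set of occupied spaces after the cars with preference list `l`
(in order of arrival) have tried to park among spaces `1, …, m`. -/
def occupied (m : ℕ) (l : List ℕ) : Finset ℕ := l.foldl (parkStep m) ∅

/-- The number of cars that leave unparked. -/
def flaws (m : ℕ) (l : List ℕ) : ℕ := l.length - (occupied m l).card

/-- The preference list (with entries in `[1, s]`) encoded by a function `Fin n → Fin s`. -/
def prefList {n s : ℕ} (f : Fin n → Fin s) : List ℕ :=
  (List.ofFn f).map (fun i => (i : ℕ) + 1)

/-- `p n m s k` is the number of `k`-flaw preference sets of length `n` with `m`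
parking spaces, all of whose entries are at most `s`. -/
def p (n m s k : ℕ) : ℕ :=
  (Finset.univ.filter (fun f : Fin n → Fin s => flaws m (prefList f) = k)).card

/-- `pL n m s k l` is the number of `k`-flaw preference sets of length `n` with `m`
parking spaces, entries at most `s`, and first entry `l`. -/
def pL (n m s k l : ℕ) : ℕ :=
  (Finset.univ.filter (fun f : Fin n → Fin s =>
    flaws m (prefList f) = k ∧ (prefList f).head? = some l)).card

/-- The set of empty spaces. -/
def empties (m : ℕ) (l : List ℕ) : Finset ℕ := Finset.Icc 1 m \ occupied m l

/-- `n_α`: the number of entries equal to the first entry. -/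
def nstat (l : List ℕ) : ℕ := l.count l.headI

/-- `h_α`: the number of empty spaces smaller than the first entry. -/
def hstat (m : ℕ) (l : List ℕ) : ℕ := ((empties m l).filter (fun x => x < l.headI)).card

/-- `τ_α`: the number of entries smaller than the first entry, plus one. -/
def taustat (l : List ℕ) : ℕ := l.countP (fun a => a < l.headI) + 1

/-- `m_α`: the largest empty space. -/
def mstat (m : ℕ) (l : List ℕ) : ℕ := (empties m l).sup id

open Finset

lemma mem_parkStep (m : ℕ) (O : Finset ℕ) (a j : ℕ) :
    j ∈ parkStep m O a ↔ j ∈ O ∨ (a ≤ j ∧ j ≤ m ∧ ∀ i, a ≤ i → i < j → i ∈ O) := by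
  unfold parkStep
  split_ifs with h
  · have h1 := Finset.min'_mem _ h
    have h2 := fun x hx => Finset.min'_le ((Finset.Icc a m) \ O) x hx
    set x := ((Finset.Icc a m) \ O).min' h
    simp only [mem_sdiff, mem_Icc, mem_insert] at *
    constructor
    · rintro (rfl | hj)
      · right
        refine ⟨h1.1.1, h1.1.2, fun i hi hij => ?_⟩
        by_contra hc
        have := h2 i ⟨⟨hi, by omega⟩, hc⟩
        omega
      · exact Or.inl hj
    · rintro (hj | ⟨ha, hm, hall⟩)
      · exact Or.inr hj
      · by_cases hj : j ∈ O
        · exact Or.inr hj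
        · left
          have := h2 j ⟨⟨ha, hm⟩, hj⟩
          by_contra hne
          exact h1.2 (hall x h1.1.1 (by omega))
  · constructor
    · exact Or.inl
    · rintro (hj | ⟨ha, hm, _⟩)
      · exact hj
      · by_contra hj
        exact h ⟨j, by simp [ha, hm, hj]⟩

lemma parkStep_comm_sub (m : ℕ) (O : Finset ℕ) (a b : ℕ) :
    parkStep m (parkStep m O a) b ⊆ parkStep m (parkStep m O b) a := by
  intro j hj
  simp only [mem_parkStep] at *
  rcases hj with (hj | ⟨h1, h2, h3⟩) | ⟨h1, h2, h3⟩
  · exact Or.inl (Or.inl hj)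
  · exact Or.inr ⟨h1, h2, fun i hi hij => Or.inl (h3 i hi hij)⟩
  · by_cases hall : ∀ i, b ≤ i → i < j → i ∈ O
    · exact Or.inl (Or.inr ⟨h1, h2, hall⟩)
    · push Not at hall
      obtain ⟨i0, hb, hj0, hO⟩ := hall
      have hA := (h3 i0 hb hj0).resolve_left hO
      right
      refine ⟨by omega, h2, fun i hi hij => ?_⟩
      rcases lt_trichotomy i i0 with h | h | h
      · exact Or.inl (hA.2.2 i hi h)
      · subst h
        right
        refine ⟨hb, hA.2.1, fun i_p hi_p hi_p_p => ?_⟩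
        rcases h3 i_p hi_p (by omega) with h4 | h4
        · exact h4
        · exact hA.2.2 i_p h4.1 hi_p_p
      · rcases h3 i (by omega) hij with h4 | h4
        · exact Or.inl h4
        · exact absurd (h4.2.2 i0 hA.1 h) hO

lemma parkStep_comm (m : ℕ) (O : Finset ℕ) (a b : ℕ) :
    parkStep m (parkStep m O a) b = parkStep m (parkStep m O b) a :=
  Subset.antisymm (parkStep_comm_sub m O a b) (parkStep_comm_sub m O b a)

lemma occupied_snoc (m : ℕ) (L : List ℕ) (a : ℕ) :
    occupied m (L ++ [a]) = parkStep m (occupied m L) a := by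
  simp [occupied]

lemma occupied_cons (m : ℕ) (L : List ℕ) (a : ℕ) :
    occupied m (a :: L) = parkStep m (occupied m L) a := by
  induction L using List.reverseRecOn with
  | nil => simp [occupied]
  | append_singleton L b ih =>
    rw [← List.cons_append, occupied_snoc, occupied_snoc, ih, parkStep_comm]

lemma subset_parkStep (m : ℕ) (O : Finset ℕ) (a : ℕ) : O ⊆ parkStep m O a := by
  intro j hj
  rw [mem_parkStep]; exact Or.inl hj

lemma card_parkStep_le (m : ℕ) (O : Finset ℕ) (a : ℕ) : (parkStep m O a).card ≤ O.card + 1 := by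
  unfold parkStep
  split_ifs
  · exact card_insert_le _ _
  · omega

lemma card_occupied_le (m : ℕ) (L : List ℕ) : (occupied m L).card ≤ L.length := by
  induction L with
  | nil => simp [occupied]
  | cons a L ih =>
    rw [occupied_cons]
    have := card_parkStep_le m (occupied m L) a
    simp; omega

lemma parkStep_full (m : ℕ) (O : Finset ℕ) (a : ℕ) (h : Icc a m ⊆ O) : parkStep m O a = O := by
  ext j
  rw [mem_parkStep]
  constructor
  · rintro (h1 | h1)
    · exact h1
    · exact h (by simp; omega)
  · exact Or.inl

lemma parkStep_not_full (m : ℕ) (O : Finset ℕ) (a : ℕ) (h : ¬ Icc a m ⊆ O) :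
    (parkStep m O a).card = O.card + 1 := by
  have hne : ((Icc a m) \ O).Nonempty := by
    rw [sdiff_nonempty]; exact h
  unfold parkStep
  rw [dif_pos hne]
  have := Finset.min'_mem _ hne
  rw [mem_sdiff] at this
  exact card_insert_of_notMem this.2

lemma occupied_sub (m : ℕ) (L : List ℕ) (hL : ∀ x ∈ L, 1 ≤ x) : occupied m L ⊆ Icc 1 m := by
  induction L with
  | nil => simp [occupied]
  | cons a L ih =>
    rw [occupied_cons]
    intro j hj
    rw [mem_parkStep] at hj
    simp only [List.mem_cons, forall_eq_or_imp] at hL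
    rcases hj with hj | hj
    · exact ih hL.2 hj
    · simp; omega

lemma occupied_le (m u : ℕ) (hu : u ≤ m) (L : List ℕ) :
    (occupied m L).filter (· ≤ u) = occupied u (L.filter (· ≤ u)) := by
  induction L with
  | nil => simp [occupied]
  | cons a L ih =>
    rw [occupied_cons]
    by_cases ha : a ≤ u
    · rw [List.filter_cons_of_pos (by simpa using ha), occupied_cons, ← ih]
      ext j
      simp only [mem_parkStep, mem_filter]
      constructor
      · rintro ⟨h1 | ⟨h1, h2, h3⟩, h4⟩
        · exact Or.inl ⟨h1, h4⟩
        · exact Or.inr ⟨h1, h4, fun i hi hij => ⟨h3 i hi hij, by omega⟩⟩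
      · rintro (⟨h1, h2⟩ | ⟨h1, h2, h3⟩)
        · exact ⟨Or.inl h1, h2⟩
        · exact ⟨Or.inr ⟨h1, by omega, fun i hi hij => (h3 i hi hij).1⟩, h2⟩
    · rw [List.filter_cons_of_neg (by simpa using ha), ← ih]
      ext j
      simp only [mem_parkStep, mem_filter]
      constructor
      · rintro ⟨h1 | ⟨h1, h2, h3⟩, h4⟩
        · exact ⟨h1, h4⟩
        · omega
      · rintro ⟨h1, h2⟩
        exact ⟨Or.inl h1, h2⟩

lemma occupied_gt (m u : ℕ) (hu : u ≤ m) (L : List ℕ)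
    (hS : (occupied u (L.filter (· ≤ u))).card = (L.filter (· ≤ u)).length) :
    (occupied m L).filter (u < ·) = occupied m (L.filter (u < ·)) := by
  induction L with
  | nil => simp [occupied]
  | cons a L ih =>
    rw [occupied_cons]
    by_cases ha : a ≤ u
    · rw [List.filter_cons_of_neg (by simpa using ha)]
      rw [List.filter_cons_of_pos (by simpa using ha), occupied_cons] at hS
      have h1 := card_occupied_le u (L.filter (· ≤ u))
      have h2 := card_parkStep_le u (occupied u (L.filter (· ≤ u))) a
      simp only [List.length_cons] at hS
      rw [← ih (by omega)]
      have hnf : ¬ Icc a u ⊆ occupied u (L.filter (· ≤ u)) := by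
        intro hf
        rw [parkStep_full _ _ _ hf] at hS
        omega
      rw [← occupied_le m u hu] at hnf
      rw [not_subset] at hnf
      obtain ⟨x, hx, hx_p⟩ := hnf
      simp only [mem_Icc, mem_filter, not_and] at hx hx_p
      have hx_p_p : x ∉ occupied m L := fun h => hx_p h hx.2
      ext j
      simp only [mem_parkStep, mem_filter]
      constructor
      · rintro ⟨h1 | ⟨h1, h2, h3⟩, h4⟩
        · exact ⟨h1, h4⟩
        · exact absurd (h3 x hx.1 (by omega)) hx_p_p
      · rintro ⟨h1, h2⟩
        exact ⟨Or.inl h1, h2⟩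
    · rw [List.filter_cons_of_neg (by simpa using ha)] at hS
      rw [List.filter_cons_of_pos (by simpa using ha), occupied_cons, ← ih hS]
      ext j
      simp only [mem_parkStep, mem_filter]
      constructor
      · rintro ⟨h1 | ⟨h1, h2, h3⟩, h4⟩
        · exact Or.inl ⟨h1, h4⟩
        · exact Or.inr ⟨h1, h2, fun i hi hij => ⟨h3 i hi hij, by omega⟩⟩
      · rintro (⟨h1, h2⟩ | ⟨h1, h2, h3⟩)
        · exact ⟨Or.inl h1, h2⟩
        · exact ⟨Or.inr ⟨h1, by omega, fun i hi hij => (h3 i hi hij).1⟩, by omega⟩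

lemma occupied_shift (m u : ℕ) (L : List ℕ) :
    occupied (m + u) (L.map (· + u)) = (occupied m L).map (addRightEmbedding u) := by
  induction L with
  | nil => simp [occupied]
  | cons a L ih =>
    rw [List.map_cons, occupied_cons, occupied_cons, ih]
    ext j
    simp only [mem_parkStep, mem_map, addRightEmbedding_apply]
    constructor
    · rintro (⟨i, hi, rfl⟩ | ⟨h1, h2, h3⟩)
      · exact ⟨i, Or.inl hi, rfl⟩
      · refine ⟨j - u, Or.inr ⟨by omega, by omega, fun i hi hij => ?_⟩, by omega⟩
        obtain ⟨i_p, hi_p, h⟩ := h3 (i + u) (by omega) (by omega)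
        have : i_p = i := by omega
        exact this ▸ hi_p
    · rintro ⟨i, hi | ⟨h1, h2, h3⟩, rfl⟩
      · exact Or.inl ⟨i, hi, rfl⟩
      · refine Or.inr ⟨by omega, by omega, fun x hx hxj => ⟨x - u, h3 _ (by omega) (by omega), by omega⟩⟩

lemma occupied_free (m e : ℕ) (hem : e ≤ m) (L : List ℕ) (hL : ∀ x ∈ L, x ≤ e)
    (he : e ∉ occupied m L) :
    (occupied m L).card = L.length ∧ ∀ x ∈ occupied m L, x < e := by
  induction L with
  | nil => simp [occupied]
  | cons a L ih =>
    simp only [List.mem_cons, forall_eq_or_imp] at hL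
    rw [occupied_cons] at he ⊢
    have he_p : e ∉ occupied m L := fun h => he (subset_parkStep _ _ _ h)
    obtain ⟨h1, h2⟩ := ih hL.2 he_p
    constructor
    · rw [parkStep_not_full, h1, List.length_cons]
      intro hf
      exact he_p (hf (by simp; omega))
    · intro x hx
      rw [mem_parkStep] at hx
      rcases hx with hx | ⟨hx1, hx2, hx3⟩
      · exact h2 x hx
      · rcases lt_trichotomy x e with h | h | h
        · exact h
        · subst h
          exact absurd (by rw [mem_parkStep]; exact Or.inr ⟨hx1, hx2, hx3⟩) he
        · exact absurd (hx3 e hL.1 h) he_p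

lemma card_split (u m : ℕ) (_hu : u ≤ m) (O : Finset ℕ) (hO : O ⊆ Icc 1 m)
    (hf : Icc (u + 1) m ⊆ O) : O.card = (O.filter (· ≤ u)).card + (m - u) := by
  rw [← card_filter_add_card_filter_not (s := O) (· ≤ u)]
  congr 1
  have : O.filter (fun x => ¬ x ≤ u) = Icc (u + 1) m := by
    ext j
    simp only [mem_filter, mem_Icc]
    constructor
    · rintro ⟨h1, h2⟩
      have := hO h1
      simp at this; omega
    · intro h
      exact ⟨hf (by simp; omega), by omega⟩
  rw [this]; simp

/-- the final equivalence on the large cars -/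
lemma big_iff (M k t : ℕ) (hk : 1 ≤ k) (ht : 1 ≤ t) (htM : t ≤ M) (B : List ℕ)
    (hB : ∀ x ∈ B, 1 ≤ x ∧ x ≤ t) (hlen : B.length = M + k - 1) :
    (occupied M B).card = M - 1 ↔ flaws (M + k) (t :: B) = 1 := by
  unfold flaws
  rw [occupied_cons, List.length_cons, hlen]
  have hBM : B.filter (· ≤ M) = B := by
    rw [List.filter_eq_self]
    intro x hx
    have := hB x hx
    simp; omega
  have hOM : (occupied (M + k) B).filter (· ≤ M) = occupied M B := by
    rw [occupied_le _ _ (by omega), hBM]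
  have hsub := occupied_sub (M + k) B (fun x hx => (hB x hx).1)
  have hle := card_occupied_le (M + k) B
  set O := occupied (M + k) B with hOdef
  by_cases hf : Icc t (M + k) ⊆ O
  · have := card_split M (M + k) (by omega) O hsub
      (fun x hx => hf (by simp at hx ⊢; omega))
    rw [hOM] at this
    rw [parkStep_full _ _ _ hf]
    omega
  · rw [parkStep_not_full _ _ _ hf]
    rw [not_subset] at hf
    obtain ⟨e, he, heO⟩ := hf
    simp at he
    obtain ⟨h1, h2⟩ := occupied_free (M + k) e he.2 B (fun x hx => by have := hB x hx; omega) heO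
    rw [← hOdef] at h1 h2
    have h3 : O ⊆ Icc 1 (M + k - 1) := by
      intro x hx
      have := hsub hx
      have := h2 x hx
      simp at *; omega
    have h4 : O = Icc 1 (M + k - 1) := by
      apply eq_of_subset_of_card_le h3
      simp; omega
    have h5 : O.filter (· ≤ M) = Icc 1 M := by
      rw [h4]; ext x; simp; omega
    rw [hOM] at h5
    rw [h5]
    simp; omega

lemma hstat_eq (n l : ℕ) (hl : 1 ≤ l) (hln : l ≤ n) (T : List ℕ) (hT : ∀ x ∈ T, 1 ≤ x) :
    hstat n (l :: T) + (occupied (l - 1) (T.filter (· ≤ l - 1))).card = l - 1 := by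
  have h1 : occupied (l - 1) (T.filter (· ≤ l - 1))
      = (occupied n (l :: T)).filter (· ≤ l - 1) := by
    rw [occupied_le _ _ (by omega), List.filter_cons_of_neg (by simp; omega)]
  have hsub := occupied_sub n (l :: T) (by simpa using ⟨hl, hT⟩)
  rw [h1]
  unfold hstat empties
  have h2 : ((Icc 1 n \ occupied n (l :: T)).filter (· < (l :: T).headI))
      = Icc 1 (l - 1) \ (occupied n (l :: T)).filter (· ≤ l - 1) := by
    ext x
    rw [mem_filter, mem_sdiff, mem_sdiff, mem_filter, mem_Icc, mem_Icc]
    change (_ ∧ x < l) ↔ _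
    constructor
    · rintro ⟨⟨a, b⟩, c⟩
      exact ⟨by omega, fun h => b h.1⟩
    · rintro ⟨a, b⟩
      exact ⟨⟨by omega, fun h => b ⟨h, by omega⟩⟩, by omega⟩
  rw [h2, card_sdiff_add_card_eq_card]
  · simp
  · intro x hx
    simp only [mem_filter] at hx
    have := hsub hx.1
    simp at *; omega

lemma park_iff (n s k l : ℕ) (hk : 1 ≤ k) (hl1 : k + 1 ≤ l) (hl2 : l + 2 ≤ s) (hsn : s ≤ n)
    (T : List ℕ) (hT : ∀ x ∈ T, 1 ≤ x ∧ x ≤ s) (hlen : T.length = n - 1) :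
    (flaws n (l :: T) = k ∧ taustat (l :: T) = l - hstat n (l :: T) ∧
      nstat (l :: T) = 1 ∧ hstat n (l :: T) = k - 1) ↔
    (flaws (l - 1) (T.filter (· ≤ l - 1)) = 0 ∧
      flaws (n + k - l) ((s - l) :: (T.filter (l < ·)).map (· - l)) = 1 ∧
      l ∉ T ∧ (T.filter (· ≤ l - 1)).length = l - k) := by
  have hn : nstat (l :: T) = 1 ↔ l ∉ T := by
    simp [nstat, List.count_eq_zero]
  have ht : taustat (l :: T) = (T.filter (· ≤ l - 1)).length + 1 := by
    change (l :: T).countP (fun a => decide (a < l)) + 1 = _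
    rw [List.countP_cons_of_neg (by simp), List.countP_eq_length_filter]
    congr 2
    apply List.filter_congr
    intro x _
    rw [Bool.eq_iff_iff]
    simp; omega
  have hh := hstat_eq n l (by omega) (by omega) T (fun x hx => (hT x hx).1)
  have hle := card_occupied_le (l - 1) (T.filter (· ≤ l - 1))
  rw [hn, ht]
  have key : ∀ (h1 : l ∉ T) (h2 : (T.filter (· ≤ l - 1)).length = l - k)
      (h3 : (occupied (l - 1) (T.filter (· ≤ l - 1))).card = l - k),
      (flaws n (l :: T) = k ↔
        flaws (n + k - l) ((s - l) :: (T.filter (l < ·)).map (· - l)) = 1) := by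
    intro h1 h2 h3
    set B := T.filter (l < ·) with hBdef
    have hBmem : ∀ x ∈ B, l < x ∧ x ≤ s := by
      intro x hx
      simp [hBdef] at hx
      exact ⟨hx.2, (hT x hx.1).2⟩
    have hBlen : B.length = n + k - l - 1 := by
      have e := List.length_eq_length_filter_add (l := T) (· ≤ l - 1)
      have : T.filter (fun x => !(decide (x ≤ l - 1))) = B := by
        apply List.filter_congr
        intro x hx
        have : x ≠ l := fun h => h1 (h ▸ hx)
        rw [Bool.eq_iff_iff]
        simp; omega
      rw [this] at e
      omega
    have hmap : (B.map (· - l)).map (· + l) = B := by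
      rw [List.map_map]
      conv_rhs => rw [← List.map_id B]
      apply List.map_congr_left
      intro x hx
      have := hBmem x hx
      simp; omega
    have hb := big_iff (n - l) k (s - l) hk (by omega) (by omega) (B.map (· - l))
      (by
        intro x hx
        simp only [List.mem_map] at hx
        obtain ⟨y, hy, rfl⟩ := hx
        have := hBmem y hy
        omega) (by simp; omega)
    rw [show n + k - l = n - l + k by omega, ← hb]
    have c1 : (occupied n B).card = (occupied (n - l) (B.map (· - l))).card := by
      have := occupied_shift (n - l) l (B.map (· - l))
      rw [hmap, Nat.sub_add_cancel (by omega)] at this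
      rw [this, card_map]
    have c2 : (occupied n (l :: B)).card = (occupied n B).card + 1 := by
      rw [occupied_cons, parkStep_not_full]
      intro hf
      have hl : l ∈ occupied n B := hf (by simp; omega)
      have h0 : (occupied n B).filter (· ≤ l) = ∅ := by
        rw [occupied_le _ _ (by omega)]
        have : B.filter (· ≤ l) = [] := by
          rw [List.filter_eq_nil_iff]
          intro x hx
          have := hBmem x hx
          simp; omega
        rw [this]; rfl
      have : l ∈ (occupied n B).filter (· ≤ l) := by simp [hl]
      rw [h0] at this
      simp at this
    have hSl : (l :: T).filter (· ≤ l - 1) = T.filter (· ≤ l - 1) :=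
      List.filter_cons_of_neg (by simp; omega)
    have hBl : (l :: T).filter (l - 1 < ·) = l :: B := by
      rw [List.filter_cons_of_pos (by simp; omega)]
      congr 1
      apply List.filter_congr
      intro x hx
      have : x ≠ l := fun h => h1 (h ▸ hx)
      rw [Bool.eq_iff_iff]
      simp; omega
    have c3 := occupied_gt n (l - 1) (by omega) (l :: T) (by rw [hSl, h2, h3])
    have c4 := occupied_le n (l - 1) (by omega) (l :: T)
    rw [hBl] at c3
    rw [hSl] at c4
    have c5 := card_filter_add_card_filter_not (s := occupied n (l :: T)) (· ≤ l - 1)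
    simp only [not_le] at c5
    rw [c3, c4, h3, c2, c1] at c5
    unfold flaws
    rw [List.length_cons, hlen]
    omega
  constructor
  · rintro ⟨h1, h2, h3, h4⟩
    have h5 : (occupied (l - 1) (T.filter (· ≤ l - 1))).card = l - k := by omega
    have h6 : (T.filter (· ≤ l - 1)).length = l - k := by omega
    refine ⟨by unfold flaws; omega, (key h3 h6 h5).1 h1, h3, h6⟩
  · rintro ⟨h1, h2, h3, h4⟩
    unfold flaws at h1
    have h5 : (occupied (l - 1) (T.filter (· ≤ l - 1))).card = l - k := by omega
    refine ⟨(key h3 h4 h5).2 h2, by omega, h3, by omega⟩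

/-- recursive counting of lists -/
noncomputable def cnt : ℕ → ℕ → (List ℕ → Prop) → ℕ
  | 0, _, R => open Classical in if R [] then 1 else 0
  | N + 1, s, R => ∑ a ∈ Icc 1 s, cnt N s (fun L => R (a :: L))

lemma cnt_congr (N s : ℕ) : ∀ (R R_p : List ℕ → Prop),
    (∀ L : List ℕ, L.length = N → (∀ x ∈ L, 1 ≤ x ∧ x ≤ s) → (R L ↔ R_p L)) →
    cnt N s R = cnt N s R_p := by
  induction N with
  | zero =>
    intro R R_p h
    have h0 := h [] rfl (by simp)
    simp only [cnt]
    by_cases h1 : R_p []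
    · rw [if_pos h1, if_pos (h0.2 h1)]
    · rw [if_neg h1, if_neg (fun h2 => h1 (h0.1 h2))]
  | succ N ih =>
    intro R R_p h
    simp only [cnt]
    apply sum_congr rfl
    intro a ha
    apply ih
    intro L hL hm
    apply h
    · simp [hL]
    · simp only [List.mem_cons, forall_eq_or_imp]
      exact ⟨by simpa using ha, hm⟩

lemma cnt_false (N s : ℕ) (R : List ℕ → Prop) (h : ∀ L, ¬ R L) : cnt N s R = 0 := by
  induction N generalizing R with
  | zero => simp [cnt, h]
  | succ N ih =>
    simp only [cnt]
    exact sum_eq_zero fun a _ => ih _ (fun L => h _)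

lemma card_eq_cnt (N s : ℕ) : ∀ (R : List ℕ → Prop) [DecidablePred (fun f : Fin N → Fin s => R (prefList f))],
    (univ.filter (fun f : Fin N → Fin s => R (prefList f))).card = cnt N s R := by
  induction N with
  | zero =>
    intro R _
    have : ∀ f : Fin 0 → Fin s, prefList f = [] := fun f => by simp [prefList]
    simp only [cnt]
    by_cases h : R []
    · rw [filter_true_of_mem (fun f _ => by rw [this]; exact h)]
      simp [h]
    · rw [filter_false_of_mem (fun f _ => by rw [this]; exact h)]
      simp [h]
  | succ N ih =>
    classical
    intro R _
    have e1 : ∑ a ∈ Icc 1 s, cnt N s (fun L => R (a :: L))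
        = ∑ a : Fin s, cnt N s (fun L => R (((a : ℕ) + 1) :: L)) := by
      rw [Fin.sum_univ_eq_sum_range (fun a => cnt N s (fun L => R ((a + 1) :: L))) s]
      rw [← Finset.Ico_add_one_right_eq_Icc, Finset.sum_Ico_eq_sum_range]
      apply sum_congr (by simp)
      intro x _
      simp [add_comm]
    simp only [cnt]
    rw [e1]
    simp_rw [← ih]
    simp_rw [Finset.card_filter]
    rw [← (Fin.consEquiv (fun _ : Fin (N + 1) => Fin s)).sum_comp, Fintype.sum_prod_type]
    apply sum_congr rfl
    intro a _
    apply sum_congr rfl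
    intro f _
    have : prefList (Fin.consEquiv (fun _ : Fin (N + 1) => Fin s) (a, f))
        = ((a : ℕ) + 1) :: prefList f := by
      simp [prefList, Fin.consEquiv, List.ofFn_succ]
    simp only [this]

lemma sum_Icc_split (s l : ℕ) (hl : 1 ≤ l) (hs : l ≤ s) (g : ℕ → ℕ) :
    ∑ a ∈ Icc 1 s, g a = ∑ a ∈ Icc 1 (l - 1), g a + g l + ∑ a ∈ Icc 1 (s - l), g (a + l) := by
  obtain ⟨d, rfl⟩ := Nat.exists_eq_add_of_le hs
  obtain ⟨u, rfl⟩ := Nat.exists_eq_add_of_le' hl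
  simp only [Nat.add_sub_cancel, Nat.add_sub_cancel_left]
  induction d with
  | zero => simp [Finset.sum_Icc_succ_top]
  | succ d ih =>
    rw [← add_assoc, Finset.sum_Icc_succ_top (by omega), ih (by omega), Finset.sum_Icc_succ_top (by omega)]
    rw [show d + 1 + (u + 1) = u + 1 + d + 1 by omega]
    omega

lemma cnt_split (s l : ℕ) (hl : 1 ≤ l) (hs : l ≤ s) (N : ℕ) : ∀ (r : ℕ) (P Q : List ℕ → Prop),
    cnt N s (fun T => P (T.filter (· ≤ l - 1)) ∧ Q ((T.filter (l < ·)).map (· - l)) ∧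
      l ∉ T ∧ (T.filter (· ≤ l - 1)).length = r)
    = N.choose r * cnt r (l - 1) P * cnt (N - r) (s - l) Q := by
  induction N with
  | zero =>
    intro r P Q
    rcases r with _ | r
    · simp only [Nat.sub_zero, cnt]
      by_cases h1 : P [] <;> by_cases h2 : Q [] <;> simp [h1, h2]
    · simp [cnt]
  | succ N ih =>
    intro r P Q
    conv_lhs => simp only [cnt]
    rw [sum_Icc_split s l hl hs]
    rw [cnt_false N s (fun L => P ((l :: L).filter (· ≤ l - 1)) ∧ _) (by simp)]
    have hbig : ∑ a ∈ Icc 1 (s - l), cnt N s (fun T =>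
        P (((a + l) :: T).filter (· ≤ l - 1)) ∧ Q ((((a + l) :: T).filter (l < ·)).map (· - l)) ∧
        l ∉ ((a + l) :: T) ∧ (((a + l) :: T).filter (· ≤ l - 1)).length = r)
        = N.choose r * cnt r (l - 1) P * cnt (N + 1 - r) (s - l) Q := by
      by_cases hr : r ≤ N
      · rw [show N + 1 - r = (N - r) + 1 by omega]
        simp only [cnt]
        rw [mul_sum]
        apply sum_congr rfl
        intro a ha
        simp only [mem_Icc] at ha
        rw [← ih r P (fun L => Q (a :: L))]
        congr 1
        funext T
        rw [List.filter_cons_of_neg (by simp; omega), List.filter_cons_of_pos (by simp; omega)]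
        simp [show a ≠ 0 by omega]
      · rw [Nat.choose_eq_zero_of_lt (by omega)]
        simp only [zero_mul]
        apply sum_eq_zero
        intro a ha
        simp only [mem_Icc] at ha
        rw [← Nat.zero_mul (cnt (N - r) (s - l) (fun L => Q (a :: L))),
          ← Nat.zero_mul (cnt r (l - 1) P), ← Nat.choose_eq_zero_of_lt (show N < r by omega),
          ← ih r P (fun L => Q (a :: L))]
        congr 1
        funext T
        rw [List.filter_cons_of_neg (by simp; omega), List.filter_cons_of_pos (by simp; omega)]
        simp [show a ≠ 0 by omega]
    rw [hbig]
    rcases r with _ | r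
    · rw [sum_eq_zero]
      · simp
      · intro a ha
        simp only [mem_Icc] at ha
        apply cnt_false
        intro L
        rw [List.filter_cons_of_pos (by simp; omega)]
        simp
    · have hsm : ∑ a ∈ Icc 1 (l - 1), cnt N s (fun T =>
          P ((a :: T).filter (· ≤ l - 1)) ∧ Q (((a :: T).filter (l < ·)).map (· - l)) ∧
          l ∉ (a :: T) ∧ ((a :: T).filter (· ≤ l - 1)).length = r + 1)
          = N.choose r * cnt (r + 1) (l - 1) P * cnt (N - r) (s - l) Q := by
        simp only [cnt]
        rw [mul_sum, sum_mul]
        apply sum_congr rfl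
        intro a ha
        simp only [mem_Icc] at ha
        rw [← ih r (fun L => P (a :: L)) Q]
        congr 1
        funext T
        rw [List.filter_cons_of_pos (by simp; omega), List.filter_cons_of_neg (by simp; omega)]
        simp [show l ≠ a by omega]
      rw [hsm, Nat.choose_succ_succ, Nat.add_sub_add_right]
      ring

lemma cnt_head (N s l : ℕ) (hl : 1 ≤ l) (hs : l ≤ s) (R : List ℕ → Prop) :
    cnt (N + 1) s (fun L => R L ∧ L.head? = some l) = cnt N s (fun T => R (l :: T)) := by
  simp only [cnt]
  rw [sum_eq_single l]
  · simp
  · intro b _ hb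
    apply cnt_false
    simp [hb]
  · intro h
    exact absurd (by simp; omega) h

theorem stmt17 (n s k l : ℕ) (hk : 1 ≤ k) (hl1 : k + 1 ≤ l) (hl2 : l ≤ s - 2) (hsn : s ≤ n) :
    (Finset.univ.filter (fun f : Fin n → Fin s =>
        flaws n (prefList f) = k ∧ (prefList f).head? = some l ∧
        taustat (prefList f) = l - hstat n (prefList f) ∧
        nstat (prefList f) = 1 ∧ hstat n (prefList f) = k - 1)).card =
      Nat.choose (n - 1) (l - k) * p (l - k) (l - 1) (l - 1) 0 *
        pL (n + k - l) (n + k - l) (s - l) 1 (s - l) := by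
  obtain ⟨N, rfl⟩ : ∃ N, n = N + 1 := ⟨n - 1, by omega⟩
  obtain ⟨q, hq⟩ : ∃ q, N + 1 + k - l = q + 1 := ⟨N + k - l, by omega⟩
  unfold p pL
  rw [card_eq_cnt _ _ (fun L => flaws (N + 1) L = k ∧ L.head? = some l ∧
        taustat L = l - hstat (N + 1) L ∧ nstat L = 1 ∧ hstat (N + 1) L = k - 1)]
  rw [card_eq_cnt _ _ (fun L => flaws (l - 1) L = 0)]
  rw [card_eq_cnt _ _ (fun L => flaws (N + 1 + k - l) L = 1 ∧ L.head? = some (s - l))]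
  have e2 : cnt (N + 1 + k - l) (s - l)
      (fun L => flaws (N + 1 + k - l) L = 1 ∧ L.head? = some (s - l))
      = cnt (N - (l - k)) (s - l) (fun T => flaws (N + 1 + k - l) ((s - l) :: T) = 1) := by
    rw [hq, cnt_head _ _ _ (by omega) le_rfl, show N - (l - k) = q by omega]
  rw [e2]
  have e1 := cnt_head N s l (by omega) (by omega) (fun L => flaws (N + 1) L = k ∧
        taustat L = l - hstat (N + 1) L ∧ nstat L = 1 ∧ hstat (N + 1) L = k - 1)
  rw [cnt_congr (N + 1) s _ (fun L => (flaws (N + 1) L = k ∧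
        taustat L = l - hstat (N + 1) L ∧ nstat L = 1 ∧ hstat (N + 1) L = k - 1) ∧
        L.head? = some l) (fun L _ _ => by tauto), e1]
  rw [cnt_congr N s _ _ (fun T hlen hT => park_iff (N + 1) s k l hk hl1 (by omega) hsn T hT hlen)]
  rw [Nat.add_sub_cancel]
  exact cnt_split s l (by omega) (by omega) N (l - k) (fun L => flaws (l - 1) L = 0)
    (fun L => flaws (N + 1 + k - l) ((s - l) :: L) = 1)
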